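/- arXiv:math/9503230 — 2 statements merged into one kernel-verified Lean document; each statement's English description precedes it below -/
import Mathlib

section
/- Let p > 3 be a prime. If p ≡ 1 (mod 4), then the restriction to B of the permutation ℤ[G]-module ℤ[G/C₄] is isomorphic as a ℤ[B]-module to ℤ[B/(s₁C₄s₁⁻¹ ∩ B)] ⊕ ℤ[B/(s₂C₄s₂⁻¹ ∩ B)] ⊕ (ℤ[B/C₂])^{(p-1)/2}, where s₁ = (1 0; x₁ 1) and s₂ = (1 0; x₂ 1) with x₁, x₂ the two distinct roots of t² + 1 in F_p (and in this case sᵢC₄sᵢ⁻¹ ⊆ B). If p ≢ 1 (mod 4), then ℤ[G/C₄] restricted to B is isomorphic to (ℤ[B/C₂])^{(p+1)/2}. -/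
open CategoryTheory Limits

attribute [local instance] Abelian.hasFiniteBiproducts

namespace AdemNaffah

variable (p : ℕ)

/-- The Borel subgroup of `SL₂(𝔽_p)`: matrices with lower-left entry `0`. -/
def BorelSL2 : Subgroup (Matrix.SpecialLinearGroup (Fin 2) (ZMod p)) where
  carrier := {g | (g : Matrix (Fin 2) (Fin 2) (ZMod p)) 1 0 = 0}
  one_mem' := by simp
  mul_mem' := by
    intro a b ha hb
    simp only [Set.mem_setOf_eq] at *
    rw [Matrix.SpecialLinearGroup.coe_mul, Matrix.mul_apply]
    simp [Fin.sum_univ_two, ha, hb]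
  inv_mem' := by
    intro a ha
    simp only [Set.mem_setOf_eq] at *
    rw [Matrix.SpecialLinearGroup.SL2_inv_expl]
    simp [ha]

/-- The unipotent lower-triangular matrix `(1 0; x 1)` in `SL₂(𝔽_p)`. -/
def unip (x : ZMod p) : Matrix.SpecialLinearGroup (Fin 2) (ZMod p) :=
  ⟨!![1, 0; x, 1], by simp [Matrix.det_fin_two_of]⟩

/-- The central element `a₂ = -I` of order 2. -/
def a2 : Matrix.SpecialLinearGroup (Fin 2) (ZMod p) :=
  ⟨!![-1, 0; 0, -1], by simp [Matrix.det_fin_two_of]⟩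

/-- The element `a₄ = (0 -1; 1 0)` of order 4. -/
def a4 : Matrix.SpecialLinearGroup (Fin 2) (ZMod p) :=
  ⟨!![0, -1; 1, 0], by simp [Matrix.det_fin_two_of]⟩

noncomputable section RepPart
variable {k : Type} [CommRing k] {Γ : Type} [Group Γ]

/-- hom of permutation modules from an equivariant function into the target -/
def permHom {X Y : Type} [MulAction Γ X] [MulAction Γ Y] (f : X → (MonoidAlgebra k Y))
    (hf : ∀ (g : Γ) (x : X), f (g • x) = Representation.ofMulAction k Γ Y g (f x)) :
    Rep.ofMulAction k Γ X ⟶ Rep.ofMulAction k Γ Y :=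
  Rep.ofHom { toLinearMap := Finsupp.linearCombination k f ∘ₗ (MonoidAlgebra.coeffLinearEquiv k).toLinearMap
              isIntertwining' := by
                intro g
                apply MonoidAlgebra.lhom_ext'
                intro x
                ext
                simp [hf] }

lemma permHom_single {X Y : Type} [MulAction Γ X] [MulAction Γ Y] (f : X → (MonoidAlgebra k Y))
    (hf : ∀ (g : Γ) (x : X), f (g • x) = Representation.ofMulAction k Γ Y g (f x)) (x : X) :
    (permHom f hf).hom.toLinearMap (MonoidAlgebra.single x 1) = f x := by
  simp [permHom]

lemma perm_ext {X : Type} [MulAction Γ X] {M : Rep k Γ} (a b : Rep.ofMulAction k Γ X ⟶ M)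
    (h : ∀ x : X, a.hom.toLinearMap (MonoidAlgebra.single x 1) = b.hom.toLinearMap (MonoidAlgebra.single x 1)) :
    a = b := by
  apply Rep.hom_ext
  apply Representation.IntertwiningMap.ext
  apply MonoidAlgebra.lhom_ext'
  intro x
  ext
  exact h x

lemma perm_eval_add {M N : Rep k Γ} (a b : M ⟶ N) (x : M) :
    (a + b).hom.toLinearMap x = a.hom.toLinearMap x + b.hom.toLinearMap x := by
  rfl

lemma perm_eval_sum {M N : Rep k Γ} {ι : Type} [Fintype ι] (a : ι → (M ⟶ N)) (x : M) :
    (∑ i, a i).hom.toLinearMap x = ∑ i, (a i).hom.toLinearMap x :=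
  map_sum (⟨⟨fun c : M ⟶ N => c.hom.toLinearMap x, rfl⟩, fun _ _ => rfl⟩ : (M ⟶ N) →+ N) a _

theorem iso_of_equiv {X Y : Type} [MulAction Γ X] [MulAction Γ Y] (e : X ≃ Y)
    (he : ∀ (g : Γ) (x : X), e (g • x) = g • e x) :
    Nonempty (Rep.ofMulAction k Γ X ≅ Rep.ofMulAction k Γ Y) := by
  refine ⟨⟨permHom (fun x => MonoidAlgebra.single (e x) 1) (by intro g x; simp [he]),
    permHom (fun x => MonoidAlgebra.single (e.symm x) 1) ?_, ?_, ?_⟩⟩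
  · intro g x
    have : e.symm (g • x) = g • e.symm x := by
      rw [Equiv.symm_apply_eq, he, Equiv.apply_symm_apply]
    simp [this]
  · apply perm_ext
    intro x
    simp [permHom]
  · apply perm_ext
    intro x
    simp [permHom]

theorem iso_sum (X Y : Type) [MulAction Γ X] [MulAction Γ Y] :
    Nonempty (Rep.ofMulAction k Γ (X ⊕ Y) ≅ Rep.ofMulAction k Γ X ⊞ Rep.ofMulAction k Γ Y) := by
  let b : BinaryBicone (Rep.ofMulAction k Γ X) (Rep.ofMulAction k Γ Y) :=
    { pt := Rep.ofMulAction k Γ (X ⊕ Y)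
      fst := permHom (Sum.elim (fun x => MonoidAlgebra.single x 1) (fun _ => 0)) (by
        rintro g (x | x) <;> simp)
      snd := permHom (Sum.elim (fun _ => 0) (fun x => MonoidAlgebra.single x 1)) (by
        rintro g (x | x) <;> simp)
      inl := permHom (fun x => MonoidAlgebra.single (Sum.inl x) 1) (by intro g x; simp)
      inr := permHom (fun x => MonoidAlgebra.single (Sum.inr x) 1) (by intro g x; simp)
      inl_fst := by apply perm_ext; intro x; simp [permHom]
      inl_snd := by apply perm_ext; intro x; simp [permHom]
      inr_fst := by apply perm_ext; intro x; simp [permHom]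
      inr_snd := by apply perm_ext; intro x; simp [permHom] }
  refine ⟨biprod.uniqueUpToIso _ _ (isBinaryBilimitOfTotal b ?_)⟩
  apply perm_ext
  rintro (x | x)
  · refine (perm_eval_add _ _ _).trans ?_
    simp [permHom, b]
  · refine (perm_eval_add _ _ _).trans ?_
    simp [permHom, b]

theorem iso_sigma {n : ℕ} (X : Type) [MulAction Γ X] :
    Nonempty (Rep.ofMulAction k Γ (Σ _ : Fin n, X) ≅ ⨁ fun _ : Fin n => Rep.ofMulAction k Γ X) := by
  let b : Bicone (fun _ : Fin n => Rep.ofMulAction k Γ X) :=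
    { pt := Rep.ofMulAction k Γ (Σ _ : Fin n, X)
      π := fun j => permHom (fun x => if x.1 = j then MonoidAlgebra.single x.2 1 else 0) (by
        rintro g ⟨i, x⟩
        by_cases h : i = j <;> simp [h])
      ι := fun j => permHom (fun x => MonoidAlgebra.single ⟨j, x⟩ 1) (by intro g x; simp)
      ι_π := by
        intro i j
        by_cases h : i = j
        · subst h
          apply perm_ext
          intro x
          simp [permHom]
        · apply perm_ext
          intro x
          simp [permHom, h] }
  refine ⟨biproduct.uniqueUpToIso _ (isBilimitOfTotal b ?_)⟩
  apply perm_ext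
  rintro ⟨i, x⟩
  refine (perm_eval_sum _ _).trans ?_
  rw [Finset.sum_eq_single i]
  · simp [permHom, b]
  · intro j _ hj
    simp [permHom, b, hj.symm]
  · simp

theorem iso_biprod {A A' B B' : Rep k Γ} (h : Nonempty (A ≅ A')) (h' : Nonempty (B ≅ B')) :
    Nonempty (A ⊞ B ≅ A' ⊞ B') := by
  obtain ⟨a⟩ := h
  obtain ⟨b⟩ := h'
  exact ⟨biprod.mapIso a b⟩

end RepPart

section GSet
variable {Γ : Type} [Group Γ] {X : Type} [MulAction Γ X]

/-- the orbit map `Γ ⧸ K → X` at a point with stabilizer `K` -/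
def orb (K : Subgroup Γ) (x : X) (h : MulAction.stabilizer Γ x = K) : Γ ⧸ K → X :=
  Quotient.lift (fun g : Γ => g • x) (by
    intro a b hab
    have h1 : a⁻¹ * b ∈ K := QuotientGroup.leftRel_apply.mp hab
    rw [← h, MulAction.mem_stabilizer_iff, mul_smul, inv_smul_eq_iff] at h1
    exact h1.symm)

lemma orb_mk (K : Subgroup Γ) (x : X) (h : MulAction.stabilizer Γ x = K) (g : Γ) :
    orb K x h (QuotientGroup.mk g) = g • x := rfl

lemma orb_smul (K : Subgroup Γ) (x : X) (h : MulAction.stabilizer Γ x = K) (g : Γ) (q : Γ ⧸ K) :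
    orb K x h (g • q) = g • orb K x h q := by
  induction q using QuotientGroup.induction_on with
  | H a =>
    rw [orb_mk, MulAction.Quotient.smul_mk, orb_mk, smul_eq_mul, mul_smul]

lemma orb_inj (K : Subgroup Γ) (x : X) (h : MulAction.stabilizer Γ x = K) :
    Function.Injective (orb K x h) := by
  intro q r hqr
  induction q using QuotientGroup.induction_on with
  | H a =>
    induction r using QuotientGroup.induction_on with
    | H b =>
      rw [orb_mk, orb_mk] at hqr
      rw [QuotientGroup.eq, ← h, MulAction.mem_stabilizer_iff, mul_smul, inv_smul_eq_iff]
      exact hqr.symm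

lemma orb_class (K : Subgroup Γ) (x : X) (h : MulAction.stabilizer Γ x = K) (q : Γ ⧸ K) :
    (Quotient.mk (MulAction.orbitRel Γ X) (orb K x h q)) = Quotient.mk _ x := by
  induction q using QuotientGroup.induction_on with
  | H a =>
    rw [orb_mk]
    exact Quotient.sound ⟨a, rfl⟩

lemma orb_surj (K : Subgroup Γ) (x : X) (h : MulAction.stabilizer Γ x = K) (y : X)
    (hy : (Quotient.mk (MulAction.orbitRel Γ X) y) = Quotient.mk _ x) : ∃ q, orb K x h q = y := by
  obtain ⟨g, hg⟩ : y ∈ MulAction.orbit Γ x := Quotient.exact hy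
  exact ⟨QuotientGroup.mk g, hg⟩

/-- all stabilizers equal -/
theorem equiv_of_stab [Finite X] [Finite Γ] (H : Subgroup Γ)
    (hst : ∀ x : X, MulAction.stabilizer Γ x = H)
    (n : ℕ) (hn : Nat.card X = n * Nat.card (Γ ⧸ H)) :
    ∃ e : (Σ _ : Fin n, Γ ⧸ H) ≃ X, ∀ (g : Γ) (x), e (g • x) = g • e x := by
  let Ω := Quotient (MulAction.orbitRel Γ X)
  let f : (Σ _ : Ω, Γ ⧸ H) → X := fun z => orb H z.1.out (hst _) z.2
  have hf : Function.Bijective f := by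
    constructor
    · rintro ⟨i, q⟩ ⟨j, r⟩ h
      have h1 := orb_class H i.out (hst _) q
      have h2 := orb_class H j.out (hst _) r
      simp only [f] at h
      rw [Quotient.out_eq] at h1 h2
      rw [h, h2] at h1
      subst h1
      rw [orb_inj _ _ _ h]
    · intro y
      obtain ⟨q, hq⟩ := orb_surj H (Quotient.mk (MulAction.orbitRel Γ X) y).out (hst _) y
        (Quotient.out_eq _).symm
      exact ⟨⟨_, q⟩, hq⟩
  let e := Equiv.ofBijective f hf
  have hc : Nat.card Ω = n := by
    have h1 := Nat.card_congr e
    rw [Nat.card_congr (Equiv.sigmaEquivProd _ _), Nat.card_prod, hn] at h1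
    exact Nat.eq_of_mul_eq_mul_right Nat.card_pos h1
  have : Finite Ω := inferInstance
  let ε : Fin n ≃ Ω := (Finite.equivFinOfCardEq hc).symm
  refine ⟨(Equiv.sigmaCongrLeft (β := fun _ => Γ ⧸ H) ε).trans e, ?_⟩
  rintro g ⟨i, q⟩
  exact orb_smul H (ε i).out (hst _) g q

theorem equiv_of_stab_two [Finite X] [Finite Γ] (H K₁ K₂ : Subgroup Γ) (x₁ x₂ : X)
    (h₁ : MulAction.stabilizer Γ x₁ = K₁) (h₂ : MulAction.stabilizer Γ x₂ = K₂)
    (h12 : x₁ ∉ MulAction.orbit Γ x₂)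
    (hst : ∀ x : X, x ∉ MulAction.orbit Γ x₁ → x ∉ MulAction.orbit Γ x₂ →
      MulAction.stabilizer Γ x = H)
    (n : ℕ) (hn : Nat.card X = Nat.card (Γ ⧸ K₁) + (Nat.card (Γ ⧸ K₂) + n * Nat.card (Γ ⧸ H))) :
    ∃ e : (Γ ⧸ K₁ ⊕ (Γ ⧸ K₂ ⊕ (Σ _ : Fin n, Γ ⧸ H))) ≃ X,
      ∀ (g : Γ) (x), e (g • x) = g • e x := by
  let c : X → Quotient (MulAction.orbitRel Γ X) := Quotient.mk _
  have hc : ∀ x y, c x = c y ↔ x ∈ MulAction.orbit Γ y := fun x y => Quotient.eq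
  have hout : ∀ ω, c ω.out = ω := fun ω => Quotient.out_eq _
  let Ω := {ω : Quotient (MulAction.orbitRel Γ X) // ω ≠ c x₁ ∧ ω ≠ c x₂}
  have hst' : ∀ ω : Ω, MulAction.stabilizer Γ ω.1.out = H := by
    rintro ⟨ω, hω1, hω2⟩
    apply hst
    · rwa [← hc, hout]
    · rwa [← hc, hout]
  let f : (Γ ⧸ K₁ ⊕ (Γ ⧸ K₂ ⊕ (Σ _ : Ω, Γ ⧸ H))) → X :=
    Sum.elim (orb K₁ x₁ h₁) (Sum.elim (orb K₂ x₂ h₂) (fun z => orb H z.1.1.out (hst' _) z.2))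
  have h12' : c x₁ ≠ c x₂ := by rwa [Ne, hc]
  have hf : Function.Bijective f := by
    constructor
    · apply Function.Injective.sumElim (orb_inj _ _ _)
      · apply Function.Injective.sumElim (orb_inj _ _ _)
        · rintro ⟨i, q⟩ ⟨j, r⟩ h
          have h1 : c _ = c _ := orb_class H i.1.out (hst' _) q
          have h2 : c _ = c _ := orb_class H j.1.out (hst' _) r
          simp only at h
          rw [hout] at h1 h2
          rw [h, h2] at h1
          have h3 := Subtype.ext h1
          subst h3
          rw [orb_inj _ _ _ h]
        · rintro q ⟨j, r⟩ h
          have h1 : c _ = c _ := orb_class K₂ x₂ h₂ q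
          have h2 : c _ = c _ := orb_class H j.1.out (hst' _) r
          rw [hout, ← h, h1] at h2
          exact j.2.2 h2.symm
      · rintro q (r | ⟨j, r⟩) h
        · have h1 : c _ = c _ := orb_class K₁ x₁ h₁ q
          have h2 : c _ = c _ := orb_class K₂ x₂ h₂ r
          rw [h] at h1
          exact h12' (h1.symm.trans h2)
        · have h1 : c _ = c _ := orb_class K₁ x₁ h₁ q
          have h2 : c _ = c _ := orb_class H j.1.out (hst' _) r
          rw [h] at h1
          rw [hout] at h2
          exact j.2.1 (h2.symm.trans h1)
    · intro y
      by_cases hy1 : c y = c x₁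
      · obtain ⟨q, hq⟩ := orb_surj K₁ x₁ h₁ y hy1
        exact ⟨Sum.inl q, hq⟩
      by_cases hy2 : c y = c x₂
      · obtain ⟨q, hq⟩ := orb_surj K₂ x₂ h₂ y hy2
        exact ⟨Sum.inr (Sum.inl q), hq⟩
      obtain ⟨q, hq⟩ := orb_surj H (c y).out (hst' ⟨c y, hy1, hy2⟩) y (hout _).symm
      exact ⟨Sum.inr (Sum.inr ⟨⟨c y, hy1, hy2⟩, q⟩), hq⟩
  let e := Equiv.ofBijective f hf
  have hcard : Nat.card Ω = n := by
    have h1 := Nat.card_congr e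
    rw [Nat.card_sum, Nat.card_sum, Nat.card_congr (Equiv.sigmaEquivProd _ _), Nat.card_prod,
      hn] at h1
    exact Nat.eq_of_mul_eq_mul_right (Nat.card_pos (α := Γ ⧸ H)) (by omega)
  let ε : Fin n ≃ Ω := (Finite.equivFinOfCardEq hcard).symm
  refine ⟨(Equiv.sumCongr (Equiv.refl _) (Equiv.sumCongr (Equiv.refl _)
    (Equiv.sigmaCongrLeft (β := fun _ => Γ ⧸ H) ε))).trans e, ?_⟩
  rintro g (q | q | ⟨i, q⟩)
  · exact orb_smul K₁ x₁ h₁ g q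
  · exact orb_smul K₂ x₂ h₂ g q
  · exact orb_smul H (ε i).1.out (hst' _) g q

end GSet

section Concrete

local notation "SLp" => Matrix.SpecialLinearGroup (Fin 2) (ZMod p)

lemma mem_borel (g : SLp) : g ∈ BorelSL2 p ↔ g.1 1 0 = 0 := Iff.rfl

lemma mul_entry (g h : SLp) (i j : Fin 2) :
    (g * h).1 i j = g.1 i 0 * h.1 0 j + g.1 i 1 * h.1 1 j := by
  change (g.1 * h.1) i j = _
  rw [Matrix.mul_apply, Fin.sum_univ_two]

lemma inv_10 (g : SLp) : (g⁻¹).1 1 0 = - g.1 1 0 := by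
  rw [Matrix.SpecialLinearGroup.SL2_inv_expl]; rfl

lemma inv_00 (g : SLp) : (g⁻¹).1 0 0 = g.1 1 1 := by
  rw [Matrix.SpecialLinearGroup.SL2_inv_expl]; rfl

lemma a2_00 : (a2 p).1 0 0 = -1 := rfl
lemma a2_01 : (a2 p).1 0 1 = 0 := rfl
lemma a2_10 : (a2 p).1 1 0 = 0 := rfl
lemma a2_11 : (a2 p).1 1 1 = -1 := rfl
lemma a4_00 : (a4 p).1 0 0 = 0 := rfl
lemma a4_01 : (a4 p).1 0 1 = -1 := rfl
lemma a4_10 : (a4 p).1 1 0 = 1 := rfl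
lemma a4_11 : (a4 p).1 1 1 = 0 := rfl
lemma unip_00 (x : ZMod p) : (unip p x).1 0 0 = 1 := rfl
lemma unip_01 (x : ZMod p) : (unip p x).1 0 1 = 0 := rfl
lemma unip_10 (x : ZMod p) : (unip p x).1 1 0 = x := rfl
lemma unip_11 (x : ZMod p) : (unip p x).1 1 1 = 1 := rfl

lemma sl_ext (g h : SLp) (h00 : g.1 0 0 = h.1 0 0) (h01 : g.1 0 1 = h.1 0 1)
    (h10 : g.1 1 0 = h.1 1 0) (h11 : g.1 1 1 = h.1 1 1) : g = h := by
  apply Subtype.ext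
  ext i j
  fin_cases i <;> fin_cases j <;> assumption

lemma a4_sq : a4 p ^ 2 = a2 p := by
  rw [pow_two]
  apply sl_ext <;> simp only [mul_entry, a4_00, a4_01, a4_10, a4_11, a2_00, a2_01, a2_10, a2_11] <;>
    ring

lemma a2_sq : a2 p ^ 2 = 1 := by
  rw [pow_two]
  apply sl_ext <;> simp only [mul_entry, a2_00, a2_01, a2_10, a2_11] <;> simp

lemma a4_four : a4 p ^ 4 = 1 := by
  rw [show 4 = 2 * 2 from rfl, pow_mul, a4_sq, a2_sq]

lemma mem_zpowers_a4 (c : SLp) (hc : c ∈ Subgroup.zpowers (a4 p)) :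
    c = 1 ∨ c = a4 p ∨ c = a2 p ∨ c = a2 p * a4 p := by
  obtain ⟨k, rfl⟩ := hc
  have h : (a4 p) ^ k = (a4 p) ^ (k % 4) := by
    conv_lhs => rw [← Int.emod_add_mul_ediv k 4]
    rw [zpow_add, zpow_mul, show (a4 p) ^ (4 : ℤ) = 1 from mod_cast a4_four p]
    simp
  simp only [h]
  have h1 := Int.emod_nonneg k (by norm_num : (4 : ℤ) ≠ 0)
  have h2 := Int.emod_lt_of_pos k (by norm_num : (0 : ℤ) < 4)
  generalize k % 4 = m at h1 h2
  interval_cases m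
  · left; simp
  · right; left; simp
  · right; right; left
    exact_mod_cast a4_sq p
  · right; right; right
    rw [← a4_sq, ← pow_succ]
    norm_cast

lemma a2_mem_borel : a2 p ∈ BorelSL2 p := a2_10 p

lemma a2_comm (g : SLp) : a2 p * g = g * a2 p := by
  apply sl_ext <;> simp only [mul_entry, a2_00, a2_01, a2_10, a2_11] <;> ring

lemma ne_zero_two [Fact p.Prime] (hp3 : 3 < p) : (2 : ZMod p) ≠ 0 := by
  intro h
  have h' : ((2 : ℕ) : ZMod p) = 0 := by exact_mod_cast h
  rw [ZMod.natCast_eq_zero_iff] at h'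
  have := Nat.le_of_dvd (by norm_num) h'
  omega

lemma a2_ne_one [Fact p.Prime] (hp3 : 3 < p) : a2 p ≠ 1 := by
  intro h
  have h1 := congrArg (fun g : SLp => g.1 0 0) h
  simp [a2] at h1
  apply ne_zero_two p hp3
  linear_combination -h1

lemma card_C4 [Fact p.Prime] (hp3 : 3 < p) : Nat.card (Subgroup.zpowers (a4 p)) = 4 := by
  rw [Nat.card_zpowers]
  have := orderOf_eq_prime_pow (x := a4 p) (p := 2) (n := 1)
    (by rw [pow_one, a4_sq]; exact a2_ne_one p hp3) (by simpa using a4_four p)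
  simpa using this

lemma card_C2 [Fact p.Prime] (hp3 : 3 < p) :
    Nat.card ((Subgroup.zpowers (a2 p)).subgroupOf (BorelSL2 p)) = 2 := by
  rw [Nat.card_congr (Subgroup.subgroupOfEquivOfLe
    (by rw [Subgroup.zpowers_le]; exact a2_mem_borel p)).toEquiv, Nat.card_zpowers]
  exact orderOf_eq_prime (a2_sq p) (a2_ne_one p hp3)

lemma card_SL [Fact p.Prime] : Nat.card SLp = p * (p - 1) * (p + 1) := by
  have h1 := Matrix.card_GL_field (𝔽 := ZMod p) 2
  let f : GL (Fin 2) (ZMod p) →* (ZMod p)ˣ := Matrix.GeneralLinearGroup.det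
  have hf : Function.Surjective f := by
    intro u
    refine ⟨Matrix.GeneralLinearGroup.mkOfDetNeZero !![(u : ZMod p), 0; 0, 1] (by simp), ?_⟩
    ext
    simp [f, Matrix.GeneralLinearGroup.mkOfDetNeZero]
  have h2 := Subgroup.card_eq_card_quotient_mul_card_subgroup f.ker
  rw [Nat.card_congr (QuotientGroup.quotientKerEquivOfSurjective f hf).toEquiv, h1,
    Nat.card_eq_fintype_card, ZMod.card_units] at h2
  have h3 : Nat.card f.ker = Nat.card SLp := by
    have : f.ker = (Matrix.SpecialLinearGroup.toGL (n := Fin 2) (R := ZMod p)).range := by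
      ext g
      rw [MonoidHom.mem_ker, MonoidHom.mem_range]
      constructor
      · intro hg
        refine ⟨⟨g.1, ?_⟩, ?_⟩
        · simpa [f] using congrArg Units.val hg
        · ext; rfl
      · rintro ⟨s, rfl⟩
        ext
        simp [f]
    rw [this]
    exact (Nat.card_congr
      (MonoidHom.ofInjective (Matrix.SpecialLinearGroup.toGL_injective)).toEquiv).symm
  rw [h3] at h2
  have hp := (Fact.out : p.Prime).two_le
  obtain ⟨q, rfl⟩ : ∃ q, p = q + 1 := ⟨p - 1, by omega⟩
  have hq : 0 < q := by omega
  apply Nat.eq_of_mul_eq_mul_left hq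
  simp only [Fin.prod_univ_two, ZMod.card, Fin.val_zero, Fin.val_one, pow_zero, pow_one,
    Nat.add_sub_cancel] at h2 ⊢
  rw [← h2]
  have e1 : (q + 1) ^ 2 - 1 = q * (q + 2) := by
    rw [Nat.sub_eq_iff_eq_add (Nat.one_le_pow _ _ (by omega))]; ring
  have e2 : (q + 1) ^ 2 - (q + 1) = q * (q + 1) := by
    rw [Nat.sub_eq_iff_eq_add (by nlinarith)]; ring
  rw [e1, e2]
  ring

/-- parametrization of the Borel subgroup -/
def borelEquiv [Fact p.Prime] : (ZMod p)ˣ × ZMod p ≃ BorelSL2 p where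
  toFun z := ⟨⟨!![(z.1 : ZMod p), z.2; 0, ((z.1⁻¹ : (ZMod p)ˣ) : ZMod p)], by
    rw [Matrix.det_fin_two_of, Units.mul_inv]; ring⟩, rfl⟩
  invFun g := ⟨⟨g.1.1 0 0, g.1.1 1 1, by
    have h := g.1.2
    have h' : g.1.1 1 0 = 0 := g.2
    rw [Matrix.det_fin_two, h'] at h
    linear_combination h, by
    have h := g.1.2
    have h' : g.1.1 1 0 = 0 := g.2
    rw [Matrix.det_fin_two, h'] at h
    linear_combination h⟩, g.1.1 0 1⟩
  left_inv := by
    rintro ⟨u, x⟩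
    refine Prod.ext (Units.ext rfl) rfl
  right_inv := by
    rintro ⟨g, hg⟩
    have h' : g.1 1 0 = 0 := hg
    apply Subtype.ext
    apply sl_ext
    · rfl
    · rfl
    · exact h'.symm
    · rfl

lemma card_borel [Fact p.Prime] : Nat.card (BorelSL2 p) = p * (p - 1) := by
  rw [← Nat.card_congr (borelEquiv p), Nat.card_prod, Nat.card_eq_fintype_card, ZMod.card_units,
    Nat.card_zmod, mul_comm]

lemma card_quot_C4 [Fact p.Prime] (hp3 : 3 < p) :
    Nat.card (SLp ⧸ Subgroup.zpowers (a4 p)) * 4 = p * (p - 1) * (p + 1) := by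
  rw [← card_SL, Subgroup.card_eq_card_quotient_mul_card_subgroup (Subgroup.zpowers (a4 p)),
    card_C4 p hp3]

lemma card_quot_C2 [Fact p.Prime] (hp3 : 3 < p) :
    Nat.card (BorelSL2 p ⧸ (Subgroup.zpowers (a2 p)).subgroupOf (BorelSL2 p)) * 2
      = p * (p - 1) := by
  rw [← card_borel, Subgroup.card_eq_card_quotient_mul_card_subgroup
    ((Subgroup.zpowers (a2 p)).subgroupOf (BorelSL2 p)), card_C2 p hp3]

lemma stab_eq (s : SLp) :
    MulAction.stabilizer (BorelSL2 p) (QuotientGroup.mk s : SLp ⧸ Subgroup.zpowers (a4 p)) =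
      (Subgroup.map (MulAut.conj s).toMonoidHom (Subgroup.zpowers (a4 p)) ⊓
              BorelSL2 p).subgroupOf (BorelSL2 p) := by
  ext b
  rw [MulAction.mem_stabilizer_iff, Subgroup.mem_subgroupOf, Subgroup.mem_inf]
  have h1 : b • (QuotientGroup.mk s : SLp ⧸ Subgroup.zpowers (a4 p)) =
    QuotientGroup.mk (b.1 * s) := rfl
  rw [h1, eq_comm, QuotientGroup.eq]
  constructor
  · intro h
    refine ⟨⟨_, h, ?_⟩, b.2⟩
    simp [mul_assoc]
  · rintro ⟨⟨c, hc, hcb⟩, -⟩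
    rw [← hcb]
    simpa [mul_assoc] using hc

lemma conj_a4_entry (g : SLp) : (g * a4 p * g⁻¹).1 1 0 = g.1 1 0 ^ 2 + g.1 1 1 ^ 2 := by
  simp only [mul_entry, a4_00, a4_01, a4_10, a4_11, inv_00, inv_10]
  ring

lemma conj_le [Fact p.Prime] (x : ZMod p) (hx : x ^ 2 + 1 = 0) :
    Subgroup.map (MulAut.conj (unip p x)).toMonoidHom (Subgroup.zpowers (a4 p)) ≤
        BorelSL2 p := by
  rw [Subgroup.map_le_iff_le_comap, Subgroup.zpowers_le, Subgroup.mem_comap, mem_borel]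
  refine (conj_a4_entry p (unip p x)).trans ?_
  rw [unip_10, unip_11]
  linear_combination hx

lemma card_quot_K [Fact p.Prime] (hp3 : 3 < p) (x : ZMod p) (hx : x ^ 2 + 1 = 0) :
    Nat.card (BorelSL2 p ⧸ (Subgroup.map (MulAut.conj (unip p x)).toMonoidHom
      (Subgroup.zpowers (a4 p)) ⊓ BorelSL2 p).subgroupOf (BorelSL2 p)) * 4
      = p * (p - 1) := by
  have h : Nat.card ((Subgroup.map (MulAut.conj (unip p x)).toMonoidHom
      (Subgroup.zpowers (a4 p)) ⊓ BorelSL2 p).subgroupOf (BorelSL2 p)) = 4 := by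
    rw [Nat.card_congr (Subgroup.subgroupOfEquivOfLe inf_le_right).toEquiv,
      inf_eq_left.mpr (conj_le p x hx),
      Subgroup.card_map_of_injective (MulAut.conj (unip p x)).injective, card_C4 p hp3]
  rw [← card_borel, Subgroup.card_eq_card_quotient_mul_card_subgroup
    ((Subgroup.map (MulAut.conj (unip p x)).toMonoidHom
      (Subgroup.zpowers (a4 p)) ⊓ BorelSL2 p).subgroupOf (BorelSL2 p)), h]

/-- generic stabilizer -/
lemma stab_generic [Fact p.Prime] (g : SLp) (hg : g.1 1 0 ^ 2 + g.1 1 1 ^ 2 ≠ 0) :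
    MulAction.stabilizer (BorelSL2 p) (QuotientGroup.mk g : SLp ⧸ Subgroup.zpowers (a4 p)) =
      (Subgroup.zpowers (a2 p)).subgroupOf (BorelSL2 p) := by
  rw [stab_eq]
  ext b
  rw [Subgroup.mem_subgroupOf, Subgroup.mem_subgroupOf, Subgroup.mem_inf]
  constructor
  · rintro ⟨⟨c, hc, hcb⟩, hb⟩
    have hcb' : g * c * g⁻¹ = b.1 := hcb
    rcases mem_zpowers_a4 p c hc with rfl | rfl | rfl | rfl
    · rw [← hcb']
      simp
    · rw [← hcb', mem_borel, conj_a4_entry] at hb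
      exact absurd hb hg
    · rw [← hcb', ← a2_comm, mul_inv_cancel_right]
      exact Subgroup.mem_zpowers _
    · rw [← hcb', ← mul_assoc, ← a2_comm, mul_assoc, mul_assoc, ← mul_assoc g,
        Subgroup.mul_mem_cancel_left _ (a2_mem_borel p), mem_borel, conj_a4_entry] at hb
      exact absurd hb hg
  · intro h
    refine ⟨?_, b.2⟩
    have h2 : Subgroup.zpowers (a2 p) ≤
        Subgroup.map (MulAut.conj g).toMonoidHom (Subgroup.zpowers (a4 p)) := by
      rw [Subgroup.zpowers_le]
      refine ⟨a2 p, ⟨2, by exact_mod_cast a4_sq p⟩, ?_⟩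
      change g * a2 p * g⁻¹ = a2 p
      rw [← a2_comm, mul_inv_cancel_right]
    exact h2 h

lemma root_of_entry [Fact p.Prime] (g : SLp) (hg : g.1 1 0 ^ 2 + g.1 1 1 ^ 2 = 0) :
    ∃ x : ZMod p, x ^ 2 + 1 = 0 ∧ g.1 1 0 = g.1 1 1 * x := by
  have hd : g.1 1 1 ≠ 0 := by
    intro h
    rw [h] at hg
    have hc : g.1 1 0 = 0 := by simpa using hg
    have := g.2
    rw [Matrix.det_fin_two, h, hc] at this
    simp at this
  refine ⟨g.1 1 0 / g.1 1 1, ?_, ?_⟩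
  · field_simp
    linear_combination hg
  · field_simp

lemma orbit_of_root [Fact p.Prime] (g : SLp) (x : ZMod p) (hg : g.1 1 0 = g.1 1 1 * x) :
    (QuotientGroup.mk g : SLp ⧸ Subgroup.zpowers (a4 p)) ∈
      MulAction.orbit (BorelSL2 p) (QuotientGroup.mk (unip p x) : SLp ⧸ Subgroup.zpowers (a4 p)) := by
  refine ⟨⟨g * (unip p x)⁻¹, ?_⟩, ?_⟩
  · rw [mem_borel, mul_entry, inv_00, inv_10, unip_10, unip_11, hg]
    ring
  · change (QuotientGroup.mk (g * (unip p x)⁻¹ * unip p x) : SLp ⧸ Subgroup.zpowers (a4 p)) = _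
    rw [inv_mul_cancel_right]

lemma orbit_ne [Fact p.Prime] (hp3 : 3 < p) (x : ZMod p) (hx : x ^ 2 + 1 = 0) :
    (QuotientGroup.mk (unip p x) : SLp ⧸ Subgroup.zpowers (a4 p)) ∉
      MulAction.orbit (BorelSL2 p)
        (QuotientGroup.mk (unip p (-x)) : SLp ⧸ Subgroup.zpowers (a4 p)) := by
  have h2 := ne_zero_two p hp3
  have hx0 : x ≠ 0 := by
    rintro rfl
    simp at hx
  rintro ⟨b, hb⟩
  have hb' : (QuotientGroup.mk (b.1 * unip p (-x)) : SLp ⧸ Subgroup.zpowers (a4 p)) =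
    QuotientGroup.mk (unip p x) := hb
  rw [QuotientGroup.eq] at hb'
  have hB : b.1⁻¹ ∈ BorelSL2 p := inv_mem b.2
  obtain ⟨c, hc⟩ : ∃ c, c = (b.1 * unip p (-x))⁻¹ * unip p x := ⟨_, rfl⟩
  rw [← hc] at hb'
  have hbc : b.1⁻¹ = unip p (-x) * c * (unip p x)⁻¹ := by
    rw [hc]; group
  rw [hbc, mem_borel] at hB
  have h10 : (1 : SLp).1 1 0 = 0 := rfl
  have h00 : (1 : SLp).1 0 0 = 1 := rfl
  have h01 : (1 : SLp).1 0 1 = 0 := rfl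
  have h11 : (1 : SLp).1 1 1 = 1 := rfl
  rcases mem_zpowers_a4 p c hb' with rfl | rfl | rfl | rfl <;>
    simp only [mul_entry, a4_00, a4_01, a4_10, a4_11, a2_00, a2_01, a2_10, a2_11, inv_00, inv_10,
      unip_00, unip_01, unip_10, unip_11, h00, h01, h10, h11] at hB
  · exact mul_ne_zero h2 hx0 (by linear_combination -hB)
  · exact h2 (by linear_combination hB + hx)
  · exact mul_ne_zero h2 hx0 (by linear_combination hB)
  · exact h2 (by linear_combination -hB + hx)

end Concrete

/-- For a prime `p > 3`: if `p ≡ 1 (mod 4)` then the restriction to the Borel subgroup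
`B` of the permutation module `ℤ[G/C₄]`, `G = SL₂(𝔽_p)`, decomposes as
`ℤ[B/(s₁C₄s₁⁻¹ ∩ B)] ⊕ ℤ[B/(s₂C₄s₂⁻¹ ∩ B)] ⊕ ℤ[B/C₂]^{(p-1)/2}`, where
`sᵢ = (1 0; xᵢ 1)` for the two roots `x₁ ≠ x₂` of `t² + 1` and `sᵢC₄sᵢ⁻¹ ⊆ B`;
otherwise it is `ℤ[B/C₂]^{(p+1)/2}`. -/
theorem perm_module_GmodC4_restrict_Borel (hp : p.Prime) (hp3 : 3 < p) :
    (p % 4 = 1 → ∃ x₁ x₂ : ZMod p, x₁ ≠ x₂ ∧ x₁ ^ 2 + 1 = 0 ∧ x₂ ^ 2 + 1 = 0 ∧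
      Subgroup.map (MulAut.conj (unip p x₁)).toMonoidHom (Subgroup.zpowers (a4 p)) ≤
        BorelSL2 p ∧
      Subgroup.map (MulAut.conj (unip p x₂)).toMonoidHom (Subgroup.zpowers (a4 p)) ≤
        BorelSL2 p ∧
      Nonempty ((Rep.ofMulAction ℤ (BorelSL2 p)
          (Matrix.SpecialLinearGroup (Fin 2) (ZMod p) ⧸ Subgroup.zpowers (a4 p))) ≅
        (Rep.ofMulAction ℤ (BorelSL2 p) ((BorelSL2 p) ⧸
            ((Subgroup.map (MulAut.conj (unip p x₁)).toMonoidHom (Subgroup.zpowers (a4 p)) ⊓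
              BorelSL2 p).subgroupOf (BorelSL2 p))) ⊞
          (Rep.ofMulAction ℤ (BorelSL2 p) ((BorelSL2 p) ⧸
            ((Subgroup.map (MulAut.conj (unip p x₂)).toMonoidHom (Subgroup.zpowers (a4 p)) ⊓
              BorelSL2 p).subgroupOf (BorelSL2 p))) ⊞
            (⨁ fun _ : Fin ((p - 1) / 2) => Rep.ofMulAction ℤ (BorelSL2 p)
              ((BorelSL2 p) ⧸ (Subgroup.zpowers (a2 p)).subgroupOf (BorelSL2 p))))))) ∧
    (p % 4 ≠ 1 →
      Nonempty ((Rep.ofMulAction ℤ (BorelSL2 p)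
          (Matrix.SpecialLinearGroup (Fin 2) (ZMod p) ⧸ Subgroup.zpowers (a4 p))) ≅
        (⨁ fun _ : Fin ((p + 1) / 2) => Rep.ofMulAction ℤ (BorelSL2 p)
          ((BorelSL2 p) ⧸ (Subgroup.zpowers (a2 p)).subgroupOf (BorelSL2 p))))) := by
  haveI : Fact p.Prime := ⟨hp⟩
  have hodd : p % 2 = 1 := by
    rcases hp.eq_two_or_odd with h | h
    · omega
    · exact h
  have hG := card_quot_C4 p hp3
  have hB := card_quot_C2 p hp3
  constructor
  · intro h4
    obtain ⟨x, hx⟩ : IsSquare (-1 : ZMod p) := ZMod.exists_sq_eq_neg_one_iff.mpr (by omega)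
    have hx1 : x ^ 2 + 1 = 0 := by linear_combination -hx
    have hx2 : (-x) ^ 2 + 1 = 0 := by linear_combination -hx
    have hx0 : x ≠ 0 := by
      rintro rfl
      simp at hx
    refine ⟨x, -x, ?_, hx1, hx2, conj_le p x hx1, conj_le p (-x) hx2, ?_⟩
    · intro h
      exact mul_ne_zero (ne_zero_two p hp3) hx0 (by linear_combination h)
    have hK1 := card_quot_K p hp3 x hx1
    have hK2 := card_quot_K p hp3 (-x) hx2
    obtain ⟨e, he⟩ := equiv_of_stab_two (Γ := BorelSL2 p)
      (X := Matrix.SpecialLinearGroup (Fin 2) (ZMod p) ⧸ Subgroup.zpowers (a4 p))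
      ((Subgroup.zpowers (a2 p)).subgroupOf (BorelSL2 p)) _ _
      (QuotientGroup.mk (unip p x)) (QuotientGroup.mk (unip p (-x)))
      (stab_eq p (unip p x)) (stab_eq p (unip p (-x))) (orbit_ne p hp3 x hx1) (by
        intro y hy1 hy2
        induction y using QuotientGroup.induction_on with
        | H g =>
          apply stab_generic
          intro hg
          obtain ⟨t, ht, hgt⟩ := root_of_entry p g hg
          have h0 : (t - x) * (t + x) = 0 := by linear_combination ht - hx1
          rcases mul_eq_zero.mp h0 with h | h
          · obtain rfl : t = x := by linear_combination h
            exact hy1 (orbit_of_root p g t hgt)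
          · obtain rfl : t = -x := by linear_combination h
            exact hy2 (orbit_of_root p g _ hgt))
      ((p - 1) / 2) (by
        obtain ⟨m, hm⟩ : ∃ m, p = 2 * m + 1 := ⟨p / 2, by omega⟩
        have e1 : (p - 1) / 2 = m := by omega
        rw [e1]
        have e2 : p - 1 = 2 * m := by omega
        have e3 : p + 1 = 2 * m + 2 := by omega
        rw [e2] at hG hB hK1 hK2
        rw [e3] at hG
        nlinarith)
    obtain ⟨i1⟩ := iso_of_equiv (k := ℤ) e he
    obtain ⟨i2⟩ := iso_sum (k := ℤ) (Γ := BorelSL2 p) ((BorelSL2 p) ⧸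
            ((Subgroup.map (MulAut.conj (unip p x)).toMonoidHom (Subgroup.zpowers (a4 p)) ⊓
              BorelSL2 p).subgroupOf (BorelSL2 p)))
        (((BorelSL2 p) ⧸
            ((Subgroup.map (MulAut.conj (unip p (-x))).toMonoidHom (Subgroup.zpowers (a4 p)) ⊓
              BorelSL2 p).subgroupOf (BorelSL2 p))) ⊕ (Σ _ : Fin ((p - 1) / 2),
              ((BorelSL2 p) ⧸ (Subgroup.zpowers (a2 p)).subgroupOf (BorelSL2 p))))
    have i3 := iso_sum (k := ℤ) (Γ := BorelSL2 p) ((BorelSL2 p) ⧸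
            ((Subgroup.map (MulAut.conj (unip p (-x))).toMonoidHom (Subgroup.zpowers (a4 p)) ⊓
              BorelSL2 p).subgroupOf (BorelSL2 p))) (Σ _ : Fin ((p - 1) / 2),
              ((BorelSL2 p) ⧸ (Subgroup.zpowers (a2 p)).subgroupOf (BorelSL2 p)))
    have i4 := iso_sigma (k := ℤ) (Γ := BorelSL2 p) (n := (p - 1) / 2)
      ((BorelSL2 p) ⧸ (Subgroup.zpowers (a2 p)).subgroupOf (BorelSL2 p))
    obtain ⟨i5⟩ := iso_biprod ⟨Iso.refl _⟩ i4
    obtain ⟨i3⟩ := i3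
    obtain ⟨i6⟩ := iso_biprod ⟨Iso.refl _⟩ ⟨i3 ≪≫ i5⟩
    exact ⟨i1.symm ≪≫ i2 ≪≫ i6⟩
  · intro h4
    obtain ⟨e, he⟩ := equiv_of_stab (Γ := BorelSL2 p)
      (X := Matrix.SpecialLinearGroup (Fin 2) (ZMod p) ⧸ Subgroup.zpowers (a4 p))
      ((Subgroup.zpowers (a2 p)).subgroupOf (BorelSL2 p)) (by
        intro y
        induction y using QuotientGroup.induction_on with
        | H g =>
          apply stab_generic
          intro hg
          obtain ⟨t, ht, -⟩ := root_of_entry p g hg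
          have := ZMod.mod_four_ne_three_of_sq_eq_neg_one (p := p) (y := t)
            (by linear_combination ht)
          omega)
      ((p + 1) / 2) (by
        obtain ⟨m, hm⟩ : ∃ m, p = 2 * m + 1 := ⟨p / 2, by omega⟩
        have e1 : (p + 1) / 2 = m + 1 := by omega
        rw [e1]
        have e2 : p - 1 = 2 * m := by omega
        have e3 : p + 1 = 2 * m + 2 := by omega
        rw [e2] at hG hB
        rw [e3] at hG
        nlinarith)
    obtain ⟨i1⟩ := iso_of_equiv (k := ℤ) e he
    obtain ⟨i2⟩ := iso_sigma (k := ℤ) (Γ := BorelSL2 p) (n := (p + 1) / 2)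
      ((BorelSL2 p) ⧸ (Subgroup.zpowers (a2 p)).subgroupOf (BorelSL2 p))
    exact ⟨i1.symm ≪≫ i2⟩

end AdemNaffah
end

section
/- Let p > 3 be a prime. Then H¹(Γ₀(p), ℤ) is a free abelian group of rank N(p), i.e. H¹(Γ₀(p), ℤ) ≅ ℤ^{N(p)}, where N(p) = (p-7)/6 if p ≡ 1 (mod 12), (p+1)/6 if p ≡ 5 (mod 12), (p-1)/6 if p ≡ 7 (mod 12), and (p+7)/6 if p ≡ 11 (mod 12). -/
open CongruenceSubgroup

namespace G0
open Matrix MatrixGroups ModularGroup UpperHalfPlane Pointwise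

noncomputable def cyc {H : Type*} [Group H] (n : ℕ) (h : H) (hh : h ^ n = 1) :
    Multiplicative (ZMod n) →* H :=
  AddMonoidHom.toMultiplicativeLeft
    (ZMod.lift n ⟨(zmultiplesHom (Additive H)) (Additive.ofMul h), by
      simp only [zmultiplesHom_apply, natCast_zsmul]; exact hh⟩)

lemma cyc_one {H : Type*} [Group H] (n : ℕ) (h : H) (hh : h ^ n = 1) (k : ℤ) :
    cyc n h hh (Multiplicative.ofAdd ((k : ℤ) : ZMod n)) = h ^ k := by
  simp [cyc]

def nn : Bool → ℕ := fun b => if b then 2 else 3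

lemma U_cube : (S * T) ^ 3 = -1 := by
  rw [pow_succ, pow_two]; ext i j; fin_cases i <;> fin_cases j <;> rfl

lemma S_sq : S ^ 2 = -1 := by
  rw [pow_two]; ext i j; fin_cases i <;> fin_cases j <;> rfl

noncomputable def PH : SL(2, ℤ) →* Equiv.Perm ℍ := MulAction.toPermHom _ _

lemma PH_neg : PH (-1) = 1 := by
  ext z; simp [PH]

lemma re_S (z : ℍ) : (S • z).re = - z.re / Complex.normSq z := by
  rw [modular_S_smul]
  rw [← UpperHalfPlane.coe_re, UpperHalfPlane.coe_mk, Complex.inv_re]; simp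

lemma re_T (z : ℍ) : (T • z).re = 1 + z.re := by
  rw [modular_T_smul]
  simp

lemma re_Tinv (z : ℍ) : (T⁻¹ • z).re = z.re - 1 := by
  have := re_T (T⁻¹ • z)
  rw [smul_inv_smul] at this
  linarith

def gs {H : Type*} (s u : H) : Bool → H := fun b => if b then s else u

lemma gs_pow {H : Type*} [Group H] {s u : H} (hs : s ^ 2 = 1) (hu : u ^ 3 = 1) (b : Bool) :
    gs s u b ^ nn b = 1 := by
  cases b <;> simp [gs, nn, *]

def pp : Bool → Set ℍ := fun b => if b then {z | 0 < z.re} else {z | z.re < 0}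

lemma normSq_pos' (z : ℍ) : 0 < Complex.normSq z := Complex.normSq_pos.2 z.ne_zero

lemma PU_cube : PH (S * T) ^ 3 = 1 := by rw [← map_pow, U_cube, PH_neg]
lemma PS_sq : PH S ^ 2 = 1 := by rw [← map_pow, S_sq, PH_neg]

noncomputable def ff {H : Type*} [Group H] {s u : H} (hs : s ^ 2 = 1) (hu : u ^ 3 = 1) (b : Bool) :
    Multiplicative (ZMod (nn b)) →* H := cyc (nn b) (gs s u b) (gs_pow hs hu b)

lemma lift_inj : Function.Injective (Monoid.CoprodI.lift (ff PS_sq PU_cube)) := by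
  refine Monoid.CoprodI.lift_injective_of_ping_pong _ (Or.inr ⟨false, ?_⟩) pp ?_ ?_ ?_
  · change 3 ≤ Cardinal.mk (ZMod 3)
    simp
  · intro b
    cases b
    · exact ⟨(-1 : ℝ) +ᵥ I, by simp [pp]⟩
    · exact ⟨(1 : ℝ) +ᵥ I, by simp [pp]⟩
  · intro i j hij
    change Disjoint (pp i) (pp j)
    rw [Set.disjoint_left]
    cases i <;> cases j <;> simp_all [pp] <;> intros <;> linarith
  · intro i j hij h hh
    obtain ⟨k, rfl⟩ : ∃ k : ℤ, Multiplicative.ofAdd ((k : ℤ) : ZMod (nn i)) = h :=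
      ⟨_, congrArg Multiplicative.ofAdd (ZMod.intCast_zmod_cast (Multiplicative.toAdd h))⟩
    rw [ff, cyc_one]
    rintro _ ⟨z, hz, rfl⟩
    have hk : ¬ ((nn i : ℕ) : ℤ) ∣ k := by
      intro hd
      apply hh
      rw [(ZMod.intCast_zmod_eq_zero_iff_dvd k (nn i)).2 hd]
      rfl
    cases i <;> cases j <;> simp [nn, gs, pp] at *
    · have h1 : PH (S * T) ^ (3:ℤ) = 1 := by exact_mod_cast PU_cube
      have h2 : PH (S * T) ^ k = PH (S * T) ∨ PH (S * T) ^ k = (PH (S * T))⁻¹ := by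
        rcases (by omega : k % 3 = 1 ∨ k % 3 = 2) with h | h
        · left
          rw [← Int.emod_add_mul_ediv k 3, h, _root_.zpow_add, _root_.zpow_mul, h1]; simp
        · right
          rw [(by omega : k = 3 * (k / 3 + 1) + (-1)), _root_.zpow_add, _root_.zpow_mul, h1]; simp
      have hn := normSq_pos' z
      rcases h2 with h2 | h2
      · rw [← map_mul, h2]
        change ((S * T) • z).re < 0
        rw [mul_smul, re_S, re_T]
        exact div_neg_of_neg_of_pos (by linarith) (normSq_pos' _)
      · rw [← map_mul, h2, ← map_inv, _root_.mul_inv_rev]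
        change ((T⁻¹ * S⁻¹) • z).re < 0
        have : S⁻¹ • z = S • z := by
          rw [inv_smul_eq_iff, ← mul_smul, ← pow_two, S_sq]; simp
        rw [mul_smul, this, re_Tinv, re_S]
        have : -z.re / Complex.normSq z < 0 := div_neg_of_neg_of_pos (by linarith) hn
        linarith
    · have h2 : PH S ^ k = PH S := by
        have h1 : PH S ^ (2:ℤ) = 1 := by exact_mod_cast PS_sq
        rw [← Int.emod_add_mul_ediv k 2, (by omega : k % 2 = 1), _root_.zpow_add, _root_.zpow_mul, h1]; simp
      rw [h2]
      change 0 < (S • z).re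
      rw [re_S]
      exact div_pos (by linarith) (normSq_pos' _)

lemma PH_mem (g : SL(2, ℤ)) : PH g ∈ (Monoid.CoprodI.lift (ff PS_sq PU_cube)).range := by
  have hS : PH S ∈ (Monoid.CoprodI.lift (ff PS_sq PU_cube)).range := by
    refine ⟨Monoid.CoprodI.of (i := true) (Multiplicative.ofAdd ((1 : ℤ) : ZMod (nn true))), ?_⟩
    rw [Monoid.CoprodI.lift_of, ff, cyc_one]; simp [gs]
  have hU : PH (S * T) ∈ (Monoid.CoprodI.lift (ff PS_sq PU_cube)).range := by
    refine ⟨Monoid.CoprodI.of (i := false) (Multiplicative.ofAdd ((1 : ℤ) : ZMod (nn false))), ?_⟩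
    rw [Monoid.CoprodI.lift_of, ff, cyc_one]; simp [gs]
  have : (⊤ : Subgroup SL(2, ℤ)) ≤ (Monoid.CoprodI.lift (ff PS_sq PU_cube)).range.comap PH := by
    rw [← SpecialLinearGroup.SL2Z_generators, Subgroup.closure_le]
    rintro x (rfl | rfl)
    · exact hS
    · have := mul_mem (inv_mem hS) hU
      rw [← map_inv, ← map_mul PH S⁻¹ (S * T), inv_mul_cancel_left] at this
      exact this
  exact this (Subgroup.mem_top g)

/-- the presentation of `PSL₂(ℤ)` -/
theorem exists_hom {H : Type*} [Group H] (s u : H) (hs : s ^ 2 = 1) (hu : u ^ 3 = 1) :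
    ∃ φ : SL(2, ℤ) →* H, φ S = s ∧ φ (S * T) = u := by
  let L := Monoid.CoprodI.lift (ff PS_sq PU_cube)
  let e := MonoidHom.ofInjective (f := L) lift_inj
  let ψ : SL(2, ℤ) →* L.range := PH.codRestrict L.range PH_mem
  have key : ∀ (b : Bool) (g : SL(2, ℤ)), PH g = gs (PH S) (PH (S * T)) b →
      (Monoid.CoprodI.lift (ff hs hu)) (e.symm (ψ g)) = gs s u b := by
    intro b g hg
    have : e.symm (ψ g) = Monoid.CoprodI.of (i := b)
        (Multiplicative.ofAdd ((1 : ℤ) : ZMod (nn b))) := by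
      rw [MulEquiv.symm_apply_eq]
      apply Subtype.ext
      change PH g = L _
      rw [Monoid.CoprodI.lift_of, ff, cyc_one, hg]; simp
    rw [this, Monoid.CoprodI.lift_of, ff, cyc_one]; simp
  exact ⟨(Monoid.CoprodI.lift (ff hs hu)).comp (e.symm.toMonoidHom.comp ψ),
    key true S rfl, key false (S * T) rfl⟩

section B
variable {X : Type}

def PP (σ : Equiv.Perm X) : Module.End ℤ (X → ℤ) := LinearMap.funLeft ℤ ℤ σ

lemma PP_apply (σ : Equiv.Perm X) (a : X → ℤ) (x : X) : PP σ a x = a (σ x) := rfl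

lemma trace_PP [Fintype X] [DecidableEq X] (σ : Equiv.Perm X) :
    LinearMap.trace ℤ (X → ℤ) (PP σ) = ((Finset.univ.filter fun x => σ x = x).card : ℤ) := by
  rw [LinearMap.trace_eq_matrix_trace ℤ (Pi.basisFun ℤ X), Matrix.trace]
  simp [PP_apply, Pi.single_apply]

lemma trace_quasi [Fintype X] (A : Module.End ℤ (X → ℤ)) (k : ℤ) (h : ∀ v, A (A v) = k • A v) :
    LinearMap.trace ℤ (X → ℤ) A = k * (Module.finrank ℤ (LinearMap.range A) : ℤ) := by
  have h1 : A = (LinearMap.range A).subtype ∘ₗ A.rangeRestrict := rfl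
  have h2 : A.rangeRestrict ∘ₗ (LinearMap.range A).subtype = k • LinearMap.id := by
    ext ⟨v, w, rfl⟩ : 2
    exact h w
  conv_lhs => rw [h1]
  rw [LinearMap.trace_comp_comm', h2, map_smul, LinearMap.trace_id, smul_eq_mul]

lemma rank_null [Fintype X] (A : Module.End ℤ (X → ℤ)) :
    Module.finrank ℤ (LinearMap.range A) + Module.finrank ℤ (LinearMap.ker A) = Fintype.card X := by
  rw [← Module.finrank_fintype_fun_eq_card ℤ, ← (LinearMap.ker A).finrank_quotient_add_finrank,
    A.quotKerEquivRange.finrank_eq]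

lemma pow_two_apply {σ : Equiv.Perm X} (h : σ ^ 2 = 1) (x : X) : σ (σ x) = x := by
  rw [← Equiv.Perm.mul_apply, ← pow_two, h]; rfl

lemma pow_three_apply {σ : Equiv.Perm X} (h : σ ^ 3 = 1) (x : X) : σ (σ (σ x)) = x := by
  have : (σ ^ 3) x = x := by rw [h]; rfl
  simpa [pow_succ] using this

lemma rank_S [Fintype X] [DecidableEq X] (σ : Equiv.Perm X) (h : σ ^ 2 = 1) :
    Fintype.card X = (Finset.univ.filter fun x => σ x = x).card
      + 2 * Module.finrank ℤ (LinearMap.ker (1 + PP σ)) := by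
  have h1 := trace_quasi (1 + PP σ) 2 (by
    intro v; ext x
    simp [PP_apply, pow_two_apply h]; ring)
  rw [map_add, trace_PP, LinearMap.trace_one, Module.finrank_fintype_fun_eq_card] at h1
  have h2 := rank_null (1 + PP σ)
  omega

lemma rank_U [Fintype X] [DecidableEq X] (σ : Equiv.Perm X) (h : σ ^ 3 = 1) :
    2 * Fintype.card X = 2 * (Finset.univ.filter fun x => σ x = x).card
      + 3 * Module.finrank ℤ (LinearMap.ker (1 + PP σ + PP (σ * σ))) := by
  have h1 := trace_quasi (1 + PP σ + PP (σ * σ)) 3 (by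
    intro v; ext x
    simp [PP_apply, pow_three_apply h]; ring)
  have h3 : (Finset.univ.filter fun x => (σ * σ) x = x) = (Finset.univ.filter fun x => σ x = x) := by
    ext x
    rw [Finset.mem_filter, Finset.mem_filter, Equiv.Perm.mul_apply]
    refine and_congr_right fun _ => ?_
    constructor
    · intro hx
      have := pow_three_apply h x
      rwa [hx] at this
    · intro hx
      rw [hx, hx]
  rw [map_add, map_add, trace_PP, trace_PP, h3, LinearMap.trace_one,
    Module.finrank_fintype_fun_eq_card] at h1
  have h2 := rank_null (1 + PP σ + PP (σ * σ))
  omega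

variable (ρ : SL(2, ℤ) →* Equiv.Perm X)

def ZZ : Submodule ℤ (SL(2, ℤ) → X → ℤ) where
  carrier := {F | ∀ g h x, F (g * h) x = F g (ρ h x) + F h x}
  zero_mem' := by intro g h x; simp
  add_mem' := by
    intro F G hF hG g h x
    simp only [Pi.add_apply, hF g h x, hG g h x]; ring
  smul_mem' := by
    intro c F hF g h x
    simp only [Pi.smul_apply, hF g h x, smul_add]

variable {ρ}

lemma ZZ_mul {F} (hF : F ∈ ZZ ρ) (g h : SL(2, ℤ)) (x : X) :
    F (g * h) x = F g (ρ h x) + F h x := hF g h x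

lemma ZZ_one {F} (hF : F ∈ ZZ ρ) (x : X) : F 1 x = 0 := by
  have := ZZ_mul hF 1 1 x
  simp at this; exact this

lemma ZZ_inv {F} (hF : F ∈ ZZ ρ) (g : SL(2, ℤ)) (x : X) : F g⁻¹ x = - F g (ρ g⁻¹ x) := by
  have := ZZ_mul hF g g⁻¹ x
  rw [mul_inv_cancel, ZZ_one hF] at this
  linarith

lemma ZZ_neg {F} (hF : F ∈ ZZ ρ) (hS : ρ S ^ 2 = 1) (x : X) : F (-1) x = 0 := by
  have h := ZZ_mul hF (-1) (-1) x
  rw [← map_pow, S_sq] at hS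
  rw [hS] at h
  simp only [neg_mul_neg, mul_one, ZZ_one hF, Equiv.Perm.coe_one, id_eq] at h
  linarith

lemma ZZ_S {F} (hF : F ∈ ZZ ρ) (hS : ρ S ^ 2 = 1) : F S ∈ LinearMap.ker (1 + PP (ρ S)) := by
  rw [LinearMap.mem_ker]
  ext x
  have h := ZZ_mul hF S S x
  rw [← pow_two, S_sq, ZZ_neg hF hS] at h
  simp [PP_apply]; linarith

lemma ZZ_U {F} (hF : F ∈ ZZ ρ) (hS : ρ S ^ 2 = 1) :
    F (S * T) ∈ LinearMap.ker (1 + PP (ρ (S * T)) + PP (ρ (S * T) * ρ (S * T))) := by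
  rw [LinearMap.mem_ker]
  generalize hU : S * T = U
  ext x
  have h := ZZ_mul hF (U * U) U x
  rw [ZZ_mul hF U U, ← pow_two, ← pow_succ, ← hU, U_cube, ZZ_neg hF hS, hU] at h
  simp [PP_apply]; linarith

noncomputable def toK (hS : ρ S ^ 2 = 1) : ZZ ρ →ₗ[ℤ]
    (LinearMap.ker (1 + PP (ρ S)) ×
      LinearMap.ker (1 + PP (ρ (S * T)) + PP (ρ (S * T) * ρ (S * T)))) where
  toFun F := (⟨F.1 S, ZZ_S F.2 hS⟩, ⟨F.1 (S * T), ZZ_U F.2 hS⟩)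
  map_add' _ _ := rfl
  map_smul' _ _ := rfl

lemma toK_inj (hS : ρ S ^ 2 = 1) : Function.Injective (toK (ρ := ρ) hS) := by
  rw [← LinearMap.ker_eq_bot, LinearMap.ker_eq_bot']
  rintro ⟨F, hF⟩ h
  have h1 : F S = 0 := congrArg (fun z => z.1.1) h
  have h2 : F (S * T) = 0 := congrArg (fun z => z.2.1) h
  have h3 : F T = 0 := by
    ext x
    have h := ZZ_mul hF S T x
    rw [h1, h2] at h
    simpa using h.symm
  apply Subtype.ext
  funext g
  change F g = 0
  have hg : g ∈ Subgroup.closure {S, T} := by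
    rw [SpecialLinearGroup.SL2Z_generators]; trivial
  induction hg using Subgroup.closure_induction with
  | mem x hx => rcases hx with rfl | rfl <;> assumption
  | one => funext x; exact ZZ_one hF x
  | mul a b _ _ ha hb => funext x; rw [ZZ_mul hF, ha, hb]; rfl
  | inv a _ ha => funext x; rw [ZZ_inv hF, ha]; rfl

/-- skew translation of `X × ℤ` -/
def sk (σ : Equiv.Perm X) (a : X → ℤ) : Equiv.Perm (X × ℤ) where
  toFun y := (σ y.1, y.2 + a y.1)
  invFun y := (σ.symm y.1, y.2 - a (σ.symm y.1))
  left_inv y := by ext <;> simp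
  right_inv y := by ext <;> simp

lemma toK_surj (hS : ρ S ^ 2 = 1) (hU : ρ (S * T) ^ 3 = 1) :
    Function.Surjective (toK (ρ := ρ) hS) := by
  rintro ⟨⟨a, ha⟩, ⟨b, hb⟩⟩
  have ha' : ∀ x, a x + a (ρ S x) = 0 := fun x => congrFun (LinearMap.mem_ker.1 ha) x
  have hb' : ∀ x, b x + b (ρ (S * T) x) + b (ρ (S * T) (ρ (S * T) x)) = 0 :=
    fun x => congrFun (LinearMap.mem_ker.1 hb) x
  obtain ⟨φ, h1, h2⟩ := exists_hom (sk (ρ S) a) (sk (ρ (S * T)) b)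
    (by
      ext1 y
      have := ha' y.1
      have := pow_two_apply hS y.1
      rw [pow_two, Equiv.Perm.mul_apply]
      ext
      · simpa [sk] using this
      · simp [sk]; linarith)
    (by
      ext1 y
      have := hb' y.1
      have := pow_three_apply hU y.1
      rw [pow_succ, pow_two, Equiv.Perm.mul_apply, Equiv.Perm.mul_apply]
      generalize ρ (S * T) = σ at *
      ext
      · simpa [sk] using this
      · simp [sk]; linarith)
  have key : ∀ g, ∃ c, φ g = sk (ρ g) c := by
    have hmul : ∀ g h, (∃ c, φ g = sk (ρ g) c) → (∃ c, φ h = sk (ρ h) c) →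
        (∃ c, φ (g * h) = sk (ρ (g * h)) c) := by
      rintro g h ⟨c, hc⟩ ⟨d, hd⟩
      refine ⟨fun x => d x + c (ρ h x), ?_⟩
      rw [map_mul, map_mul, hc, hd]
      ext y
      · simp [sk]
      · simp [sk]; ring
    have hinv : ∀ g, (∃ c, φ g = sk (ρ g) c) → (∃ c, φ g⁻¹ = sk (ρ g⁻¹) c) := by
      rintro g ⟨c, hc⟩
      refine ⟨fun x => - c ((ρ g)⁻¹ x), ?_⟩
      rw [map_inv, map_inv, hc, inv_eq_iff_mul_eq_one]
      ext y
      · simp [sk]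
      · simp [sk]
    intro g
    have hg : g ∈ Subgroup.closure {S, T} := by
      rw [SpecialLinearGroup.SL2Z_generators]; trivial
    induction hg using Subgroup.closure_induction with
    | mem x hx =>
      rcases hx with rfl | rfl
      · exact ⟨a, h1⟩
      · have := hmul _ _ (hinv _ ⟨a, h1⟩) ⟨b, h2⟩
        rwa [inv_mul_cancel_left] at this
    | one => exact ⟨0, by ext y <;> simp [sk]⟩
    | mul a b _ _ ha hb => exact hmul _ _ ha hb
    | inv a _ ha => exact hinv _ ha
  choose F hF using key
  have hsk : ∀ (σ τ : Equiv.Perm X) (c d : X → ℤ), sk σ c = sk τ d → c = d := by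
    intro σ τ c d h
    funext x
    have := congrArg (fun e : Equiv.Perm (X × ℤ) => (e (x, 0)).2) h
    simpa [sk] using this
  refine ⟨⟨F, ?_⟩, ?_⟩
  · intro g h x
    have e := hF (g * h)
    rw [map_mul, hF g, hF h] at e
    have := congrArg (fun e : Equiv.Perm (X × ℤ) => (e (x, 0)).2) e
    simp [sk] at this
    linarith
  · refine Prod.ext (Subtype.ext ?_) (Subtype.ext ?_)
    · exact hsk _ _ _ _ ((hF S).symm.trans h1)
    · exact hsk _ _ _ _ ((hF (S * T)).symm.trans h2)

noncomputable def eK (hS : ρ S ^ 2 = 1) (hU : ρ (S * T) ^ 3 = 1) :=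
  LinearEquiv.ofBijective (toK (ρ := ρ) hS) ⟨toK_inj hS, toK_surj hS hU⟩

variable (ρ) in
def dd : (X → ℤ) →ₗ[ℤ] ZZ ρ where
  toFun a := ⟨fun g x => a (ρ g x) - a x, by intro g h x; simp⟩
  map_add' a b := by ext g x; simp; ring
  map_smul' c a := by ext g x; simp; ring

variable (Γ : Subgroup SL(2, ℤ)) (x0 : X)

def res (hΓ : ∀ g, g ∈ Γ ↔ ρ g x0 = x0) : ZZ ρ →ₗ[ℤ] (Additive Γ →+ ℤ) where
  toFun F := AddMonoidHom.mk' (fun γ => F.1 (Additive.toMul γ).1 x0) (by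
    intro a b
    have := ZZ_mul F.2 (Additive.toMul a).1 (Additive.toMul b).1 x0
    rw [(hΓ _).1 (Additive.toMul b).2] at this
    exact this)
  map_add' _ _ := rfl
  map_smul' _ _ := rfl

lemma res_surj (hΓ : ∀ g, g ∈ Γ ↔ ρ g x0 = x0) (ht : ∀ x, ∃ g, ρ g x0 = x) :
    Function.Surjective (res (ρ := ρ) Γ x0 hΓ) := by
  intro f
  choose r hr using ht
  have hm : ∀ g x, (r (ρ g x))⁻¹ * g * r x ∈ Γ := by
    intro g x
    rw [hΓ, map_mul, map_mul, map_inv, Equiv.Perm.mul_apply, hr, Equiv.Perm.mul_apply,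
      Equiv.Perm.inv_eq_iff_eq, hr]
  let F : SL(2, ℤ) → X → ℤ := fun g x => f (Additive.ofMul ⟨_, hm g x⟩)
  have hF : F ∈ ZZ ρ := by
    intro g h x
    change f _ = f _ + f _
    rw [← map_add, ← ofMul_mul]
    congr 2
    apply Subtype.ext
    simp only [map_mul, Equiv.Perm.mul_apply, Subgroup.coe_mul]
    group
  have h0 : r x0 ∈ Γ := (hΓ _).2 (hr _)
  refine ⟨⟨F, hF⟩, DFunLike.ext _ _ fun γ => ?_⟩
  change f (Additive.ofMul (⟨(r (ρ (Additive.toMul γ).1 x0))⁻¹ * (Additive.toMul γ).1 * r x0, hm _ _⟩ : Γ))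
    = f γ
  have : Additive.ofMul
      (⟨(r (ρ (Additive.toMul γ).1 x0))⁻¹ * (Additive.toMul γ).1 * r x0, hm _ _⟩ : Γ) =
      - Additive.ofMul (⟨r x0, h0⟩ : Γ) + (γ : Additive Γ) + Additive.ofMul (⟨r x0, h0⟩ : Γ) := by
    apply Additive.toMul.injective
    apply Subtype.ext
    change (r (ρ (Additive.toMul γ).1 x0))⁻¹ * (Additive.toMul γ).1 * r x0 =
      (r x0)⁻¹ * (Additive.toMul γ).1 * r x0
    rw [(hΓ _).1 (Additive.toMul γ).2]
  rw [this]
  simp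

lemma ker_res (hΓ : ∀ g, g ∈ Γ ↔ ρ g x0 = x0) (ht : ∀ x, ∃ g, ρ g x0 = x) :
    LinearMap.ker (res (ρ := ρ) Γ x0 hΓ) = LinearMap.range (dd ρ) := by
  choose r hr using ht
  ext F
  rw [LinearMap.mem_ker]
  constructor
  · intro h
    have h' : ∀ γ ∈ Γ, F.1 γ x0 = 0 := fun γ hγ =>
      DFunLike.congr_fun h (Additive.ofMul (⟨γ, hγ⟩ : Γ))
    have h'' : ∀ g h, ρ g x0 = ρ h x0 → F.1 g x0 = F.1 h x0 := by
      intro g h e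
      have hm : h⁻¹ * g ∈ Γ := by
        rw [hΓ, map_mul, map_inv, Equiv.Perm.mul_apply, Equiv.Perm.inv_eq_iff_eq, e]
      have := ZZ_mul F.2 h (h⁻¹ * g) x0
      rwa [mul_inv_cancel_left, (hΓ _).1 hm, h' _ hm, add_zero] at this
    refine ⟨fun x => F.1 (r x) x0, ?_⟩
    apply Subtype.ext
    funext g x
    change F.1 (r (ρ g x)) x0 - F.1 (r x) x0 = F.1 g x
    have := ZZ_mul F.2 g (r x) x0
    rw [hr, h'' (g * r x) (r (ρ g x)) (by rw [map_mul, Equiv.Perm.mul_apply, hr, hr])] at this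
    linarith
  · rintro ⟨a, rfl⟩
    ext γ
    change a (ρ (Additive.toMul γ).1 x0) - a x0 = 0
    rw [(hΓ _).1 (Additive.toMul γ).2, sub_self]

lemma ker_dd (ht : ∀ x, ∃ g, ρ g x0 = x) :
    LinearMap.ker (dd ρ) = Submodule.span ℤ {(1 : X → ℤ)} := by
  ext a
  rw [LinearMap.mem_ker, Submodule.mem_span_singleton]
  constructor
  · intro h
    refine ⟨a x0, ?_⟩
    funext x
    obtain ⟨g, rfl⟩ := ht x
    have : a (ρ g x0) - a x0 = 0 := congrFun (congrFun (congrArg Subtype.val h) g) x0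
    simp; linarith
  · rintro ⟨c, rfl⟩
    apply Subtype.ext
    funext g x
    change (c • (1 : X → ℤ)) _ - (c • (1 : X → ℤ)) _ = 0
    simp

theorem main_rank [Fintype X] [DecidableEq X]
    (hΓ : ∀ g, g ∈ Γ ↔ ρ g x0 = x0) (ht : ∀ x, ∃ g, ρ g x0 = x)
    (hS : ρ S ^ 2 = 1) (hU : ρ (S * T) ^ 3 = 1) :
    Module.Finite ℤ (Additive Γ →+ ℤ) ∧ ∃ r s : ℕ,
      Fintype.card X = (Finset.univ.filter fun x => ρ S x = x).card + 2 * r ∧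
      2 * Fintype.card X = 2 * (Finset.univ.filter fun x => ρ (S * T) x = x).card + 3 * s ∧
      Module.finrank ℤ (Additive Γ →+ ℤ) + Fintype.card X = r + s + 1 := by
  have : Module.Finite ℤ (ZZ ρ) := Module.Finite.equiv (eK hS hU).symm
  have fin := Module.Finite.of_surjective _ (res_surj Γ x0 hΓ ht)
  refine ⟨fin, _, _, rank_S _ hS, rank_U _ hU, ?_⟩
  have e1 := (eK hS hU).finrank_eq
  rw [Module.finrank_prod] at e1
  have e2 := (LinearMap.ker (res (ρ := ρ) Γ x0 hΓ)).finrank_quotient_add_finrank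
  rw [((res (ρ := ρ) Γ x0 hΓ).quotKerEquivOfSurjective (res_surj Γ x0 hΓ ht)).finrank_eq,
    ker_res Γ x0 hΓ ht] at e2
  have e3 := (LinearMap.ker (dd ρ)).finrank_quotient_add_finrank
  rw [(dd ρ).quotKerEquivRange.finrank_eq, ker_dd x0 ht, Module.finrank_fintype_fun_eq_card] at e3
  have e4 : Module.finrank ℤ (Submodule.span ℤ {(1 : X → ℤ)}) = 1 := by
    have hne : (1 : X → ℤ) ≠ 0 := fun h => one_ne_zero (congrFun h x0)
    rw [← (LinearEquiv.toSpanNonzeroSingleton ℤ (X → ℤ) 1 hne).finrank_eq, Module.finrank_self]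
  omega

end B
section C
variable (p : ℕ) [hp : Fact p.Prime]

noncomputable def gm : SL(2, ℤ) →* GL (Fin 2) (ZMod p) :=
  SpecialLinearGroup.toGL.comp (SpecialLinearGroup.map (Int.castRingHom (ZMod p)))

lemma gm_apply (g : SL(2, ℤ)) (i j : Fin 2) : gm p g i j = ((g i j : ℤ) : ZMod p) := rfl

noncomputable def rr : SL(2, ℤ) →* Equiv.Perm (OnePoint (ZMod p)) :=
  (MulAction.toPermHom (GL (Fin 2) (ZMod p)) (OnePoint (ZMod p))).comp (gm p)

lemma rr_infty (g : SL(2, ℤ)) : rr p g OnePoint.infty =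
    if ((g 1 0 : ℤ) : ZMod p) = 0 then OnePoint.infty
      else (((g 0 0 : ℤ) : ZMod p) / ((g 1 0 : ℤ) : ZMod p) : ZMod p) :=
  OnePoint.smul_infty_eq_ite (gm p g)

lemma rr_some (g : SL(2, ℤ)) (k : ZMod p) : rr p g (k : OnePoint (ZMod p)) =
    if (g 1 0 : ZMod p) * k + (g 1 1 : ZMod p) = 0 then OnePoint.infty
      else (((g 0 0 : ZMod p) * k + (g 0 1 : ZMod p)) /
        ((g 1 0 : ZMod p) * k + (g 1 1 : ZMod p)) : ZMod p) :=
  OnePoint.smul_some_eq_ite (g := gm p g)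

lemma rr_neg : rr p (-1) = 1 := by
  ext x
  induction x using OnePoint.rec with
  | infty => rw [rr_infty]; simp
  | coe k => rw [rr_some]; simp

lemma rr_S (k : ZMod p) : rr p S (k : OnePoint (ZMod p)) = k ↔ k ^ 2 = -1 := by
  rw [rr_some]
  by_cases hk : k = 0
  · subst hk; simp [S]
  · simp [S, hk]
    rw [div_eq_iff hk]
    constructor <;> intro h <;> linear_combination -h

lemma rr_S_infty : rr p S OnePoint.infty ≠ OnePoint.infty := by
  rw [rr_infty]; simp [S]

lemma U_entries : ((S * T) 0 0 = 0 ∧ (S * T) 0 1 = -1) ∧ ((S * T) 1 0 = 1 ∧ (S * T) 1 1 = 1) := by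
  refine ⟨⟨rfl, rfl⟩, rfl, rfl⟩

lemma rr_U (k : ZMod p) :
    rr p (S * T) (k : OnePoint (ZMod p)) = k ↔ k ^ 2 + k + 1 = 0 := by
  obtain ⟨⟨h1, h2⟩, h3, h4⟩ := U_entries
  rw [rr_some, h1, h2, h3, h4]
  by_cases hk : k + 1 = 0
  · have : k = -1 := by linear_combination hk
    subst this; simp
  · simp [hk]
    rw [div_eq_iff hk]
    constructor <;> intro h <;> linear_combination -h

lemma rr_U_infty : rr p (S * T) OnePoint.infty ≠ OnePoint.infty := by
  obtain ⟨⟨h1, h2⟩, h3, h4⟩ := U_entries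
  rw [rr_infty, h3]; simp

lemma fix_card [Fintype (OnePoint (ZMod p))] [DecidableEq (OnePoint (ZMod p))] (σ : Equiv.Perm (OnePoint (ZMod p)))
    (P : ZMod p → Prop) [DecidablePred P]
    (h : ∀ k : ZMod p, σ k = k ↔ P k) (hi : σ OnePoint.infty ≠ OnePoint.infty) :
    (Finset.univ.filter fun x => σ x = x).card = (Finset.univ.filter P).card := by
  rw [← Finset.card_map (⟨((↑) : ZMod p → OnePoint (ZMod p)), OnePoint.coe_injective⟩)]
  congr 1
  ext x
  induction x using OnePoint.rec with
  | infty => simp [hi]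
  | coe k => simp [h]

lemma rr_trans (x : OnePoint (ZMod p)) : ∃ g, rr p g OnePoint.infty = x := by
  induction x using OnePoint.rec with
  | infty => exact ⟨1, by simp⟩
  | coe k =>
    obtain ⟨g, h0, h1⟩ : ∃ g : SL(2, ℤ), g 0 0 = (k.val : ℤ) ∧ g 1 0 = 1 :=
      ⟨⟨!![(k.val : ℤ), -1; 1, 0], by simp [Matrix.det_fin_two]⟩, rfl, rfl⟩
    refine ⟨g, ?_⟩
    rw [rr_infty, h0, h1]; simp

lemma card_S (h2 : 2 < p) : (p % 4 = 1 ∧ (Finset.univ.filter fun k : ZMod p => k ^ 2 = -1).card = 2) ∨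
    (p % 4 = 3 ∧ (Finset.univ.filter fun k : ZMod p => k ^ 2 = -1).card = 0) := by
  have hodd : p % 2 = 1 := hp.out.eq_two_or_odd.resolve_left (by omega)
  have : Fact (2 < p) := ⟨h2⟩
  by_cases h : p % 4 = 3
  · right
    refine ⟨h, ?_⟩
    rw [Finset.card_eq_zero, Finset.filter_eq_empty_iff]
    intro k _ hk
    exact (ZMod.exists_sq_eq_neg_one_iff (p := p)).1 ⟨k, by rw [← hk, pow_two]⟩ h
  · left
    refine ⟨by omega, ?_⟩
    obtain ⟨i, hi⟩ := (ZMod.exists_sq_eq_neg_one_iff (p := p)).2 h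
    have hi0 : i ≠ 0 := by rintro rfl; simp at hi
    rw [Finset.card_eq_two]
    refine ⟨i, -i, fun e => ?_, ?_⟩
    · rcases (ZMod.neg_eq_self_iff i).1 e.symm with e | e
      · exact hi0 e
      · omega
    ext k
    simp only [Finset.mem_filter, Finset.mem_univ, true_and, Finset.mem_insert,
      Finset.mem_singleton]
    rw [hi, ← pow_two, sq_eq_sq_iff_eq_or_eq_neg]

lemma card_U (h3 : 3 < p) :
    (p % 3 = 1 ∧ (Finset.univ.filter fun k : ZMod p => k ^ 2 + k + 1 = 0).card = 2) ∨
    (p % 3 = 2 ∧ (Finset.univ.filter fun k : ZMod p => k ^ 2 + k + 1 = 0).card = 0) := by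
  have hp3 : ¬ 3 ∣ p := fun h => by
    have := (Nat.prime_dvd_prime_iff_eq Nat.prime_three hp.out).1 h
    omega
  have h30 : (3 : ZMod p) ≠ 0 := by
    intro h
    have : ((3 : ℕ) : ZMod p) = 0 := by exact_mod_cast h
    rw [ZMod.natCast_eq_zero_iff] at this
    exact absurd (Nat.le_of_dvd (by norm_num) this) (by omega)
  have hcard : Fintype.card (ZMod p)ˣ = p - 1 := ZMod.card_units p
  by_cases h : p % 3 = 1
  · left
    refine ⟨h, ?_⟩
    obtain ⟨w, hw⟩ := exists_prime_orderOf_dvd_card (G := (ZMod p)ˣ) 3 (by rw [hcard]; omega)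
    have hw3 : (w : ZMod p) ^ 3 = 1 := by
      rw [← Units.val_pow_eq_pow_val, ← hw, pow_orderOf_eq_one]; rfl
    have hw1 : (w : ZMod p) - 1 ≠ 0 := by
      intro h
      have : w = 1 := Units.ext (by simpa using sub_eq_zero.1 h)
      rw [this] at hw; simp at hw
    have hz : (w : ZMod p) ^ 2 + w + 1 = 0 := by
      apply mul_left_cancel₀ hw1
      linear_combination hw3
    generalize (w : ZMod p) = v at *
    rw [Finset.card_eq_two]
    refine ⟨v, -1 - v, ?_, ?_⟩
    · intro e
      apply h30
      linear_combination (-1 - 2 * v) * e + 4 * hz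
    · ext k
      simp only [Finset.mem_filter, Finset.mem_univ, true_and, Finset.mem_insert,
        Finset.mem_singleton]
      constructor
      · intro hk
        have : (k - v) * (k - (-1 - v)) = 0 := by linear_combination hk - hz
        rcases mul_eq_zero.1 this with h | h
        · exact Or.inl (sub_eq_zero.1 h)
        · exact Or.inr (sub_eq_zero.1 h)
      · rintro (rfl | rfl)
        · exact hz
        · linear_combination hz
  · right
    refine ⟨by omega, ?_⟩
    rw [Finset.card_eq_zero, Finset.filter_eq_empty_iff]
    intro k _ hk
    have hk3 : k ^ 3 = 1 := by linear_combination (k - 1) * hk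
    have hk0 : k ≠ 0 := by rintro rfl; simp at hk
    have hk1 : k ≠ 1 := by
      rintro rfl
      apply h30; linear_combination hk
    have ho : orderOf k = 3 := orderOf_eq_prime hk3 hk1
    have := orderOf_dvd_of_pow_eq_one (ZMod.pow_card_sub_one_eq_one hk0)
    rw [ho] at this
    omega

end C

end G0

/-- The integral first cohomology of `Γ₀(p)` for a prime `p > 3` is free abelian
of rank `N(p)`, where `N(p)` depends on `p mod 12` as in Adem–Naffah. -/
theorem H1_Gamma0_free_of_rank_Np (p : ℕ) (hp : p.Prime) (hp3 : 3 < p) (N : ℕ)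
    (hN : (p % 12 = 1 ∧ N = (p - 7) / 6) ∨ (p % 12 = 5 ∧ N = (p + 1) / 6) ∨
      (p % 12 = 7 ∧ N = (p - 1) / 6) ∨ (p % 12 = 11 ∧ N = (p + 7) / 6)) :
    Nonempty ((groupCohomology (Rep.trivial ℤ (Gamma0 p) ℤ) 1) ≃ₗ[ℤ] (Fin N → ℤ)) := by
  have : Fact p.Prime := ⟨hp⟩
  classical
  let : Fintype (OnePoint (ZMod p)) := inferInstanceAs (Fintype (Option (ZMod p)))
  have hc : Fintype.card (OnePoint (ZMod p)) = p + 1 := by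
    rw [← Nat.card_eq_fintype_card]
    change Nat.card (Option (ZMod p)) = p + 1
    rw [Finite.card_option, Nat.card_zmod]
  obtain ⟨hfin, r, s, h1, h2, h3⟩ := G0.main_rank (ρ := G0.rr p) (Gamma0 p) OnePoint.infty
    (fun g => by
      rw [G0.rr_infty, Gamma0_mem]
      by_cases h : ((g 1 0 : ℤ) : ZMod p) = 0 <;> simp [h])
    (G0.rr_trans p) (by rw [← map_pow, G0.S_sq, G0.rr_neg])
    (by rw [← map_pow, G0.U_cube, G0.rr_neg])
  rw [G0.fix_card p _ _ (G0.rr_S p) (G0.rr_S_infty p), hc] at h1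
  rw [G0.fix_card p _ _ (G0.rr_U p) (G0.rr_U_infty p), hc] at h2
  rw [hc] at h3
  have hr : Module.finrank ℤ (Additive (Gamma0 p) →+ ℤ) = N := by
    rcases G0.card_S p (by omega) with ⟨a1, a2⟩ | ⟨a1, a2⟩ <;>
    rcases G0.card_U p hp3 with ⟨b1, b2⟩ | ⟨b1, b2⟩ <;>
    rw [a2] at h1 <;> rw [b2] at h2 <;> omega
  have hfree : Module.Free ℤ (Additive (Gamma0 p) →+ ℤ) := by
    have : Module.IsTorsionFree ℤ (Additive (Gamma0 p) →+ ℤ) := by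
      exact Function.Injective.moduleIsTorsionFree
        (fun f : Additive (Gamma0 p) →+ ℤ => (f : Additive (Gamma0 p) → ℤ))
        DFunLike.coe_injective (fun _ _ => rfl)
    infer_instance
  let e1 := (groupCohomology.H1IsoOfIsTrivial (Rep.trivial ℤ (Gamma0 p) ℤ)).toLinearEquiv
  let e2 : (Additive (Gamma0 p) →+ ℤ) ≃ₗ[ℤ] (Fin N → ℤ) :=
    LinearEquiv.ofFinrankEq _ _ (by rw [hr]; simp)
  exact ⟨e1.trans e2⟩
end
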